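/- Let p, p′ : ℕ → ℝ be probability mass functions with p(0) = p′(0) = 0 such that p′(i) > 0 whenever p(i) > 0 and KL(p, p′) is finite. Then for every n ≥ 1, KL(p^{∗n}, p′^{∗n}) ≤ n · KL(p, p′). -/

import Mathlib

open MeasureTheory
open scoped BigOperators Classical

noncomputable section

/-- Discrete convolution of two sequences. -/
def conv (a b : ℕ → ℝ) : ℕ → ℝ := fun i => ∑ k ∈ Finset.range (i + 1), a k * b (i - k)

/-- The sequence δ₀ with δ₀(0) = 1 and δ₀(k) = 0 for k ≥ 1. -/
def delta0 : ℕ → ℝ := fun i => if i = 0 then 1 else 0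

/-- Convolution powers: a^{∗0} = δ₀, a^{∗(n+1)} = a^{∗n} ∗ a. -/
def convPow (a : ℕ → ℝ) : ℕ → ℕ → ℝ
  | 0 => delta0
  | n + 1 => conv (convPow a n) a

/-- The ℓ¹ norm of a sequence. -/
def l1 (a : ℕ → ℝ) : ℝ := ∑' i, |a i|

/-- exp(a) = ∑_{j=0}^∞ a^{∗j}/j!, defined coordinatewise. -/
def expSeq (a : ℕ → ℝ) : ℕ → ℝ := fun i => ∑' j, convPow a j i / (Nat.factorial j : ℝ)

/-- p is a probability mass function on ℕ₀. -/
def IsPMF (p : ℕ → ℝ) : Prop := (∀ i, 0 ≤ p i) ∧ ∑' i, p i = 1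

/-- Kullback–Leibler divergence. -/
def KL (u v : ℕ → ℝ) : ℝ := ∑' i, u i * Real.log (u i / v i)

/-- The V divergence. -/
def Vd (u v : ℕ → ℝ) : ℝ := ∑' i, u i * (Real.log (u i / v i)) ^ 2

/-- Squared Hellinger distance. -/
def hellSq (u v : ℕ → ℝ) : ℝ := ∑' i, (Real.sqrt (u i) - Real.sqrt (v i)) ^ 2

/-- Hellinger distance. -/
def hell (u v : ℕ → ℝ) : ℝ := Real.sqrt (hellSq u v)

/-- The compound Poisson distribution of (λ, p). -/
def cpq (lam : ℝ) (p : ℕ → ℝ) : ℕ → ℝ :=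
  fun i => ∑' n, Real.exp (-lam) * lam ^ n / (Nat.factorial n : ℝ) * convPow p n i

theorem mul_log_div_ge {a b t : ℝ} (ha : 0 ≤ a) (hb : 0 ≤ b) (hab : 0 < a → 0 < b) (ht : 0 < t) :
    a * Real.log t + a - b * t ≤ a * Real.log (a / b) := by
  rcases ha.eq_or_lt with rfl | ha
  · simpa using mul_nonneg hb ht.le
  · have hb' := hab ha
    have h := Real.one_sub_inv_le_log_of_pos (x := a / (b * t)) (by positivity)
    have hlog : Real.log (a / (b * t)) = Real.log (a / b) - Real.log t := by
      rw [← div_div, Real.log_div (by positivity) ht.ne']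
    rw [hlog, inv_div] at h
    have h2 := mul_le_mul_of_nonneg_left h ha.le
    have h3 : a * (1 - b * t / a) = a - b * t := by field_simp
    linarith

/-- The log-sum inequality. -/
theorem sum_mul_log_sum_div_le {ι : Type*} (s : Finset ι) {a b : ι → ℝ} (ha : ∀ i ∈ s, 0 ≤ a i)
    (hb : ∀ i ∈ s, 0 ≤ b i) (hab : ∀ i ∈ s, 0 < a i → 0 < b i) :
    (∑ i ∈ s, a i) * Real.log ((∑ i ∈ s, a i) / ∑ i ∈ s, b i) ≤
      ∑ i ∈ s, a i * Real.log (a i / b i) := by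
  rcases (Finset.sum_nonneg ha).eq_or_lt with h | h
  · have hz := (Finset.sum_eq_zero_iff_of_nonneg ha).1 h.symm
    rw [← h, zero_mul, Finset.sum_eq_zero fun i hi => by rw [hz i hi, zero_mul]]
  · obtain ⟨i, hi, hai⟩ := (Finset.sum_pos_iff_of_nonneg ha).1 h
    have hB : 0 < ∑ i ∈ s, b i := Finset.sum_pos' hb ⟨i, hi, hab i hi hai⟩
    have key := Finset.sum_le_sum fun i hi =>
      mul_log_div_ge (ha i hi) (hb i hi) (hab i hi) (div_pos h hB)
    rw [Finset.sum_sub_distrib, Finset.sum_add_distrib, ← Finset.sum_mul, ← Finset.sum_mul,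
      mul_div_cancel₀ _ hB.ne'] at key
    linarith

/-- `u` and `v` are probability mass functions, `u` is absolutely continuous with respect to `v`,
and their Kullback–Leibler divergence is finite. -/
structure FiniteKL (u v : ℕ → ℝ) : Prop where
  left_nonneg : ∀ i, 0 ≤ u i
  right_nonneg : ∀ i, 0 ≤ v i
  hasSum_left : HasSum u 1
  hasSum_right : HasSum v 1
  pos : ∀ i, 0 < u i → 0 < v i
  summable : Summable fun i => u i * Real.log (u i / v i)

theorem IsPMF.hasSum {p : ℕ → ℝ} (hp : IsPMF p) : HasSum p 1 := by
  have hs : Summable p := by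
    by_contra h
    simpa [tsum_eq_zero_of_not_summable h] using hp.2
  simpa [hp.2] using hs.hasSum

theorem conv_nonneg {a b : ℕ → ℝ} (ha : ∀ i, 0 ≤ a i) (hb : ∀ i, 0 ≤ b i) (i : ℕ) :
    0 ≤ conv a b i :=
  Finset.sum_nonneg fun k _ => mul_nonneg (ha k) (hb (i - k))

theorem hasSum_conv {a b : ℕ → ℝ} (ha : Summable a) (hb : Summable b) :
    HasSum (conv a b) ((∑' i, a i) * ∑' i, b i) :=
  hasSum_sum_range_mul_of_summable_norm ha.norm hb.norm

theorem hasSum_conv_one {a b : ℕ → ℝ} (ha : HasSum a 1) (hb : HasSum b 1) :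
    HasSum (conv a b) 1 := by
  simpa [ha.tsum_eq, hb.tsum_eq] using hasSum_conv ha.summable hb.summable

namespace FiniteKL

variable {u v p q : ℕ → ℝ}

theorem mul_pos_of_mul_pos (huv : FiniteKL u v) (hpq : FiniteKL p q) {k l : ℕ}
    (h : 0 < u k * p l) : 0 < v k * q l :=
  mul_pos (huv.pos k (pos_of_mul_pos_left h (hpq.left_nonneg l)))
    (hpq.pos l (pos_of_mul_pos_right h (huv.left_nonneg k)))

theorem conv_pos (huv : FiniteKL u v) (hpq : FiniteKL p q) (i : ℕ) (h : 0 < conv u p i) :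
    0 < conv v q i := by
  obtain ⟨k, hk, hpos⟩ := (Finset.sum_pos_iff_of_nonneg
    fun k _ => mul_nonneg (huv.left_nonneg k) (hpq.left_nonneg (i - k))).1 h
  exact Finset.sum_pos'
    (fun k _ => mul_nonneg (huv.right_nonneg k) (hpq.right_nonneg (i - k)))
    ⟨k, hk, huv.mul_pos_of_mul_pos hpq hpos⟩

theorem mul_mul_log_div (huv : FiniteKL u v) (hpq : FiniteKL p q) (k l : ℕ) :
    u k * p l * Real.log (u k * p l / (v k * q l)) =
      u k * Real.log (u k / v k) * p l + u k * (p l * Real.log (p l / q l)) := by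
  rcases (huv.left_nonneg k).eq_or_lt with hu | hu
  · simp [← hu]
  rcases (hpq.left_nonneg l).eq_or_lt with hp | hp
  · simp [← hp]
  have hv := huv.pos k hu
  have hq := hpq.pos l hp
  rw [mul_div_mul_comm, Real.log_mul (by positivity) (by positivity)]
  ring

theorem conv_mul_log_div_le (huv : FiniteKL u v) (hpq : FiniteKL p q) (i : ℕ) :
    conv u p i * Real.log (conv u p i / conv v q i) ≤
      conv (fun k => u k * Real.log (u k / v k)) p i +
        conv u (fun l => p l * Real.log (p l / q l)) i := by
  have h := sum_mul_log_sum_div_le (Finset.range (i + 1))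
    (a := fun k => u k * p (i - k)) (b := fun k => v k * q (i - k))
    (fun k _ => mul_nonneg (huv.left_nonneg k) (hpq.left_nonneg (i - k)))
    (fun k _ => mul_nonneg (huv.right_nonneg k) (hpq.right_nonneg (i - k)))
    (fun k _ => huv.mul_pos_of_mul_pos hpq)
  simp only [huv.mul_mul_log_div hpq, Finset.sum_add_distrib] at h
  exact h

theorem hasSum_conv_bound (huv : FiniteKL u v) (hpq : FiniteKL p q) :
    HasSum (fun i => conv (fun k => u k * Real.log (u k / v k)) p i +
        conv u (fun l => p l * Real.log (p l / q l)) i) (KL u v + KL p q) := by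
  simpa [KL, huv.hasSum_left.tsum_eq, hpq.hasSum_left.tsum_eq] using
    (hasSum_conv huv.summable hpq.hasSum_left.summable).add
      (hasSum_conv huv.hasSum_left.summable hpq.summable)

protected theorem conv (huv : FiniteKL u v) (hpq : FiniteKL p q) :
    FiniteKL (conv u p) (conv v q) where
  left_nonneg := conv_nonneg huv.left_nonneg hpq.left_nonneg
  right_nonneg := conv_nonneg huv.right_nonneg hpq.right_nonneg
  hasSum_left := hasSum_conv_one huv.hasSum_left hpq.hasSum_left
  hasSum_right := hasSum_conv_one huv.hasSum_right hpq.hasSum_right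
  pos := huv.conv_pos hpq
  summable := by
    have hL : Summable fun i => conv u p i - conv v q i :=
      (hasSum_conv_one huv.hasSum_left hpq.hasSum_left).summable.sub
        (hasSum_conv_one huv.hasSum_right hpq.hasSum_right).summable
    have hlow (i : ℕ) : conv u p i - conv v q i ≤
        conv u p i * Real.log (conv u p i / conv v q i) := by
      simpa using mul_log_div_ge (conv_nonneg huv.left_nonneg hpq.left_nonneg i)
        (conv_nonneg huv.right_nonneg hpq.right_nonneg i) (huv.conv_pos hpq i) one_pos
    have h := Summable.of_nonneg_of_le (fun i => sub_nonneg.2 (hlow i))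
      (fun i => sub_le_sub_right (huv.conv_mul_log_div_le hpq i) _)
      ((huv.hasSum_conv_bound hpq).summable.sub hL)
    simpa using h.add hL

theorem kl_conv_le (huv : FiniteKL u v) (hpq : FiniteKL p q) :
    KL (conv u p) (conv v q) ≤ KL u v + KL p q :=
  hasSum_le (huv.conv_mul_log_div_le hpq) (huv.conv hpq).summable.hasSum
    (huv.hasSum_conv_bound hpq)

theorem delta0_self : FiniteKL delta0 delta0 where
  left_nonneg i := by unfold delta0; split_ifs <;> norm_num
  right_nonneg i := by unfold delta0; split_ifs <;> norm_num
  hasSum_left := hasSum_ite_eq 0 1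
  hasSum_right := hasSum_ite_eq 0 1
  pos _ h := h
  summable := by simp

protected theorem convPow (hpq : FiniteKL p q) : ∀ n, FiniteKL (convPow p n) (convPow q n)
  | 0 => delta0_self
  | n + 1 => (hpq.convPow n).conv hpq

theorem kl_convPow_le (hpq : FiniteKL p q) (n : ℕ) :
    KL (convPow p n) (convPow q n) ≤ n * KL p q := by
  induction n with
  | zero => simp [KL, convPow]
  | succ n ih =>
    have h : KL (convPow p (n + 1)) (convPow q (n + 1)) ≤ _ := (hpq.convPow n).kl_conv_le hpq
    push_cast
    linarith

end FiniteKL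

/-- KL(p^{∗n}, p′^{∗n}) ≤ n · KL(p, p′). -/
theorem stmt9 (p p' : ℕ → ℝ) (hp : IsPMF p) (hp' : IsPMF p') (h0 : p 0 = 0) (h0' : p' 0 = 0)
    (habs : ∀ i, 0 < p i → 0 < p' i)
    (hKL : Summable fun i => p i * Real.log (p i / p' i)) :
    ∀ n : ℕ, 1 ≤ n → KL (convPow p n) (convPow p' n) ≤ n * KL p p' := by
  exact fun n _ =>
    FiniteKL.kl_convPow_le ⟨hp.1, hp'.1, hp.hasSum, hp'.hasSum, habs, hKL⟩ n
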